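/- In the scalar case, for C₁ > 0, C₂ > 0, J₂, J₁, A₁, A₂, b₁, b₂, η₁, η₂ ∈ ℝ with J₂ ≥ 0, define V₁(x,z) = ½J₁x² - η₁x + (z - A₁x - b₁)²/(2C₁) and V₂(z,y) = ½J₂z² - η₂z + (y - A₂z - b₂)²/(2C₂). Then the infimum over z of V₁(x,z) + V₂(z,y) is attained, and equals ½Jx² - ηx + (y - Ax - b)²/(2C) + κ, where A = A₂A₁/(1+C₁J₂), b = A₂(b₁ + C₁η₂)/(1+C₁J₂) + b₂, C = A₂²C₁/(1+C₁J₂) + C₂, η = A₁(η₂ - J₂b₁)/(1+C₁J₂) + η₁, J = A₁²J₂/(1+C₁J₂) + J₁, and κ is a constant independent of x and y. -/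

import Mathlib

theorem iInf_quadratic_aux (R k z₀ : ℝ) (hk : 0 ≤ k) :
    (⨅ z : ℝ, (R + k * (z - z₀) ^ 2)) = R := by
  have h : ∀ z : ℝ, R ≤ R + k * (z - z₀) ^ 2 := fun z =>
    le_add_of_nonneg_right (mul_nonneg hk (sq_nonneg (z - z₀)))
  apply le_antisymm
  · refine (ciInf_le ⟨R, ?_⟩ z₀).trans (le_of_eq ?_)
    · rintro _ ⟨z, rfl⟩
      exact h z
    · rw [sub_self]
      ring
  · exact le_ciInf h

/-- Scalar instantiation of the LQT conditional value function combination: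
the infimum over `z` of `V₁(x,z) + V₂(z,y)` is attained and equals a quadratic
of the same form with the combined parameters, up to a constant `κ`. -/
theorem scalar_lqt_combination_attained
    (A₁ A₂ b₁ b₂ η₁ η₂ J₁ J₂ C₁ C₂ : ℝ)
    (hC₁ : 0 < C₁) (hC₂ : 0 < C₂) (hJ₂ : 0 ≤ J₂) :
    ∃ κ : ℝ, ∀ x y : ℝ,
      (∃ z₀ : ℝ, ∀ z : ℝ,
          (1 / 2) * J₁ * x ^ 2 - η₁ * x + (z₀ - A₁ * x - b₁) ^ 2 / (2 * C₁)
            + ((1 / 2) * J₂ * z₀ ^ 2 - η₂ * z₀ + (y - A₂ * z₀ - b₂) ^ 2 / (2 * C₂))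
          ≤ (1 / 2) * J₁ * x ^ 2 - η₁ * x + (z - A₁ * x - b₁) ^ 2 / (2 * C₁)
            + ((1 / 2) * J₂ * z ^ 2 - η₂ * z + (y - A₂ * z - b₂) ^ 2 / (2 * C₂))) ∧
      (⨅ z : ℝ,
          ((1 / 2) * J₁ * x ^ 2 - η₁ * x + (z - A₁ * x - b₁) ^ 2 / (2 * C₁)
            + ((1 / 2) * J₂ * z ^ 2 - η₂ * z + (y - A₂ * z - b₂) ^ 2 / (2 * C₂))))
        = (1 / 2) * ((A₁ ^ 2 * J₂ / (1 + C₁ * J₂) + J₁)) * x ^ 2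
          - (A₁ * (η₂ - J₂ * b₁) / (1 + J₂ * C₁) + η₁) * x
          + (y - (A₂ * A₁ / (1 + C₁ * J₂)) * x
              - (A₂ * (b₁ + C₁ * η₂) / (1 + C₁ * J₂) + b₂)) ^ 2
            / (2 * (A₂ ^ 2 * C₁ / (1 + C₁ * J₂) + C₂))
          + κ := by
  have hD : 0 < 1 + C₁ * J₂ := by positivity
  have hE : 0 < (1 + C₁ * J₂) * C₂ + A₂ ^ 2 * C₁ := by positivity
  have hCC : A₂ ^ 2 * C₁ / (1 + C₁ * J₂) + C₂
      = ((1 + C₁ * J₂) * C₂ + A₂ ^ 2 * C₁) / (1 + C₁ * J₂) := by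
    field_simp
    ring
  refine ⟨(J₂ * b₁ ^ 2 - 2 * η₂ * b₁ - C₁ * η₂ ^ 2) / (2 * (1 + C₁ * J₂)), fun x y => ?_⟩
  rw [hCC, mul_comm J₂ C₁]
  obtain ⟨z₀, hz₀⟩ : ∃ z₀ : ℝ, z₀ = (C₂ * (A₁ * x + b₁ + C₁ * η₂) + C₁ * A₂ * (y - b₂))
      / ((1 + C₁ * J₂) * C₂ + A₂ ^ 2 * C₁) := ⟨_, rfl⟩
  have key : ∀ z : ℝ, (1 / 2) * J₁ * x ^ 2 - η₁ * x + (z - A₁ * x - b₁) ^ 2 / (2 * C₁)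
            + ((1 / 2) * J₂ * z ^ 2 - η₂ * z + (y - A₂ * z - b₂) ^ 2 / (2 * C₂))
        = ((1 / 2) * ((A₁ ^ 2 * J₂ / (1 + C₁ * J₂) + J₁)) * x ^ 2
          - (A₁ * (η₂ - J₂ * b₁) / (1 + C₁ * J₂) + η₁) * x
          + (y - (A₂ * A₁ / (1 + C₁ * J₂)) * x
              - (A₂ * (b₁ + C₁ * η₂) / (1 + C₁ * J₂) + b₂)) ^ 2
            / (2 * (((1 + C₁ * J₂) * C₂ + A₂ ^ 2 * C₁) / (1 + C₁ * J₂)))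
          + (J₂ * b₁ ^ 2 - 2 * η₂ * b₁ - C₁ * η₂ ^ 2) / (2 * (1 + C₁ * J₂)))
          + ((1 + C₁ * J₂) * C₂ + A₂ ^ 2 * C₁) / (2 * C₁ * C₂) * (z - z₀) ^ 2 := by
    intro z
    rw [hz₀]
    have h1 := hD.ne'
    have h2 := hE.ne'
    field_simp
    ring
  have hk : 0 ≤ ((1 + C₁ * J₂) * C₂ + A₂ ^ 2 * C₁) / (2 * C₁ * C₂) := by positivity
  simp only [key]
  refine ⟨⟨z₀, fun z => ?_⟩, ?_⟩
  · have := mul_nonneg hk (sq_nonneg (z - z₀))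
    rw [sub_self]
    linarith
  · exact iInf_quadratic_aux _ _ _ hk
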